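/- For p = 1, any c > 0, and any probabilistic polyline sets X and Y over a metric space (E, d), the DAP similarity satisfies 0 ≤ S_PLD^{(c,1)}(X, Y) ≤ (1/2)·min{R_X, R_Y} = min{S_PLD^{(c,1)}(X, X), S_PLD^{(c,1)}(Y, Y)}. -/

import Mathlib

open scoped BigOperators

/-- A polyline: a finite sequence of points of `E`, given by its length and an
indexing function. -/
def Polyline (E : Type*) : Type _ := Σ n : ℕ, Fin n → E

/-- An ordered assignment set between `{1,…,n}` and `{1,…,m}`: each first index and each
second index appears at most once, and the pairs respect a strictly increasing order. -/
def IsOrderedAssignment {n m : ℕ} (θ : Finset (Fin n × Fin m)) : Prop :=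
  ∀ a ∈ θ, ∀ b ∈ θ, (a.1 < b.1 ↔ a.2 < b.2)

/-- A (not necessarily ordered) assignment set: each first index and each second index
appears at most once. -/
def IsAssignment {n m : ℕ} (θ : Finset (Fin n × Fin m)) : Prop :=
  ∀ a ∈ θ, ∀ b ∈ θ, (a.1 = b.1 ↔ a.2 = b.2)

/-- The assignment cost `C(θ, x, y)` of an assignment set `θ` between polylines `x` and `y`. -/
noncomputable def cost {E : Type*} [MetricSpace E] (c p : ℝ) (x y : Polyline E)
    (θ : Finset (Fin x.1 × Fin y.1)) : ℝ :=
  (∑ ij ∈ θ, dist (x.2 ij.1) (y.2 ij.2) ^ p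
    + c ^ p / 2 * ((x.1 : ℝ) + (y.1 : ℝ) - 2 * (θ.card : ℝ))) ^ (1 / p)

/-- The SOSPA distance: the minimum assignment cost over all ordered assignment sets. -/
noncomputable def dSOSPA {E : Type*} [MetricSpace E] (c p : ℝ) (x y : Polyline E) : ℝ :=
  ⨅ θ : {θ : Finset (Fin x.1 × Fin y.1) // IsOrderedAssignment θ}, cost c p x y θ.1

/-- The normalized SOSPA, valued in `[0,1]`, with the convention that it is `0` when
both polylines are empty. -/
noncomputable def dSOSPAn {E : Type*} [MetricSpace E] (c p : ℝ) (x y : Polyline E) : ℝ :=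
  if x.1 = 0 ∧ y.1 = 0 then 0
  else 2 * dSOSPA c p x y /
    ((c ^ p / 2 * ((x.1 : ℝ) + (y.1 : ℝ))) ^ (1 / p) + dSOSPA c p x y)

/-- The cost of a trace `T` (an ordered assignment set) for the generalized edit distance
with substitution costs `γsub`, deletion costs `γdel`, and insertion costs `γins`. -/
noncomputable def traceCost {n m : ℕ} (γsub : Fin n → Fin m → ℝ) (γdel : Fin n → ℝ)
    (γins : Fin m → ℝ) (T : Finset (Fin n × Fin m)) : ℝ :=
  ∑ ij ∈ T, γsub ij.1 ij.2
    + ∑ i ∈ Finset.univ.filter (fun i => ∀ j, (i, j) ∉ T), γdel i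
    + ∑ j ∈ Finset.univ.filter (fun j => ∀ i, (i, j) ∉ T), γins j

/-- The composition `θ₁ ∘ θ₂` of two assignment sets. -/
def composeAssignment {n k m : ℕ} (θ₁ : Finset (Fin n × Fin k)) (θ₂ : Finset (Fin k × Fin m)) :
    Finset (Fin n × Fin m) :=
  Finset.univ.filter fun im => ∃ j, (im.1, j) ∈ θ₁ ∧ (j, im.2) ∈ θ₂

/-- The cyclic shift `S_s(x)` of a polyline `x`: the `k`-th point of `S_s(x)` is the
`⟨k+s⟩_{|x|}`-th point of `x`. -/
def shift {E : Type*} (s : ℕ) (x : Polyline E) : Polyline E :=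
  ⟨x.1, fun i => x.2 ⟨((i : ℕ) + s) % x.1, Nat.mod_lt _ i.pos⟩⟩

/-- A probabilistic polyline set: a finite indexed family of confidence–polyline pairs,
with confidences in `[0,1]`. -/
structure PPSet (E : Type*) where
  n : ℕ
  r : Fin n → ℝ
  poly : Fin n → Polyline E
  r_nonneg : ∀ i, 0 ≤ r i
  r_le_one : ∀ i, r i ≤ 1

/-- `R_X`, the total confidence of a probabilistic polyline set. -/
noncomputable def totalR {E : Type*} (X : PPSet E) : ℝ := ∑ i, X.r i

/-- The DAP distance `d_PLD^{(c,p)}` between two probabilistic polyline sets. -/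
noncomputable def dPLD {E : Type*} [MetricSpace E] (c p : ℝ) (X Y : PPSet E) : ℝ :=
  (⨅ θ : {θ : Finset (Fin X.n × Fin Y.n) // IsAssignment θ},
    (∑ ij ∈ θ.1, (min (X.r ij.1) (Y.r ij.2) * dSOSPAn c p (X.poly ij.1) (Y.poly ij.2) ^ p
        + |X.r ij.1 - Y.r ij.2| / 2)
      + (∑ i ∈ Finset.univ.filter (fun i => ∀ j, (i, j) ∉ θ.1), X.r i
          + ∑ j ∈ Finset.univ.filter (fun j => ∀ i, (i, j) ∉ θ.1), Y.r j) / 2)) ^ (1 / p)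

/-- The DAP similarity (for `p = 1`). -/
noncomputable def SPLD {E : Type*} [MetricSpace E] (c : ℝ) (X Y : PPSet E) : ℝ :=
  ((totalR X + totalR Y) / 2 - dPLD c 1 X Y) / 2

/-- The normalized DAP, with the convention that it equals `0` when the denominator is `0`. -/
noncomputable def dPLDn {E : Type*} [MetricSpace E] (c p : ℝ) (X Y : PPSet E) : ℝ :=
  if ((totalR X + totalR Y) / 2) ^ (1 / p) + dPLD c p X Y = 0 then 0
  else 2 * dPLD c p X Y / (((totalR X + totalR Y) / 2) ^ (1 / p) + dPLD c p X Y)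

/-- The multiset of confidence–polyline pairs of a probabilistic polyline set. -/
def PPSet.toMultiset {E : Type*} (X : PPSet E) : Multiset (ℝ × Polyline E) :=
  Finset.univ.val.map fun i => (X.r i, X.poly i)
theorem IsAssignment.injOn_fst {n m : ℕ} {θ : Finset (Fin n × Fin m)} (h : IsAssignment θ) :
    Set.InjOn Prod.fst (θ : Set (Fin n × Fin m)) :=
  fun a ha b hb hab => Prod.ext hab ((h a ha b hb).1 hab)

theorem IsAssignment.injOn_snd {n m : ℕ} {θ : Finset (Fin n × Fin m)} (h : IsAssignment θ) :
    Set.InjOn Prod.snd (θ : Set (Fin n × Fin m)) :=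
  fun a ha b hb hab => Prod.ext ((h a ha b hb).2 hab) hab

theorem IsOrderedAssignment.isAssignment {n m : ℕ} {θ : Finset (Fin n × Fin m)}
    (h : IsOrderedAssignment θ) : IsAssignment θ := fun a ha b hb => by
  have h₁ := h a ha b hb
  have h₂ := h b hb a ha
  omega

theorem IsAssignment.empty {n m : ℕ} : IsAssignment (∅ : Finset (Fin n × Fin m)) := by
  simp [IsAssignment]

theorem IsOrderedAssignment.diagonal (n : ℕ) :
    IsOrderedAssignment (Finset.univ.image fun i : Fin n => (i, i)) := by
  simp [IsOrderedAssignment]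

theorem IsAssignment.card_le_left {n m : ℕ} {θ : Finset (Fin n × Fin m)} (h : IsAssignment θ) :
    θ.card ≤ n := by
  simpa using Finset.card_le_card_of_injOn (t := Finset.univ) Prod.fst (by simp) h.injOn_fst

theorem IsAssignment.card_le_right {n m : ℕ} {θ : Finset (Fin n × Fin m)} (h : IsAssignment θ) :
    θ.card ≤ m := by
  simpa using Finset.card_le_card_of_injOn (t := Finset.univ) Prod.snd (by simp) h.injOn_snd

/-- Splitting a sum over the left index set into matched and unmatched indices. -/
theorem IsAssignment.sum_fst_add_sum_unmatched {n m : ℕ} {θ : Finset (Fin n × Fin m)}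
    (h : IsAssignment θ) (f : Fin n → ℝ) :
    ∑ ij ∈ θ, f ij.1 + ∑ i ∈ Finset.univ.filter (fun i => ∀ j, (i, j) ∉ θ), f i = ∑ i, f i := by
  rw [← Finset.sum_image (f := f) h.injOn_fst,
    ← Finset.sum_filter_add_sum_filter_not Finset.univ (fun i => ∃ j, (i, j) ∈ θ)]
  congr 1
  · congr 1
    ext i
    simp
  · simp

/-- Splitting a sum over the right index set into matched and unmatched indices. -/
theorem IsAssignment.sum_snd_add_sum_unmatched {n m : ℕ} {θ : Finset (Fin n × Fin m)}
    (h : IsAssignment θ) (f : Fin m → ℝ) :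
    ∑ ij ∈ θ, f ij.2 + ∑ j ∈ Finset.univ.filter (fun j => ∀ i, (i, j) ∉ θ), f j = ∑ j, f j := by
  rw [← Finset.sum_image (f := f) h.injOn_snd,
    ← Finset.sum_filter_add_sum_filter_not Finset.univ (fun j => ∃ i, (i, j) ∈ θ)]
  congr 1
  · congr 1
    ext j
    simp
  · simp

section

variable {E : Type*} [MetricSpace E] {c : ℝ}

theorem cost_nonneg (hc : 0 < c) (p : ℝ) (x y : Polyline E) {θ : Finset (Fin x.1 × Fin y.1)}
    (hθ : IsOrderedAssignment θ) : 0 ≤ cost c p x y θ := by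
  have h₁ : (θ.card : ℝ) ≤ x.1 := mod_cast hθ.isAssignment.card_le_left
  have h₂ : (θ.card : ℝ) ≤ y.1 := mod_cast hθ.isAssignment.card_le_right
  have h₃ : (0 : ℝ) ≤ x.1 + y.1 - 2 * θ.card := by linarith
  unfold cost
  positivity

theorem dSOSPA_nonneg (hc : 0 < c) (p : ℝ) (x y : Polyline E) : 0 ≤ dSOSPA c p x y :=
  Real.iInf_nonneg fun θ => cost_nonneg hc p x y θ.2

theorem dSOSPA_self (hc : 0 < c) {p : ℝ} (hp : p ≠ 0) (x : Polyline E) : dSOSPA c p x x = 0 := by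
  refine le_antisymm ?_ (dSOSPA_nonneg hc p x x)
  refine (ciInf_le (Set.finite_range _).bddBelow ⟨_, IsOrderedAssignment.diagonal x.1⟩).trans_eq ?_
  have hinj : Function.Injective fun i : Fin x.1 => (i, i) := fun i j h => (Prod.ext_iff.1 h).1
  rw [cost, Finset.sum_image hinj.injOn, Finset.card_image_of_injective _ hinj]
  simp only [dist_self, Real.zero_rpow hp, Finset.sum_const_zero, Finset.card_univ,
    Fintype.card_fin]
  rw [← two_mul, sub_self, mul_zero, add_zero, Real.zero_rpow (one_div_ne_zero hp)]

theorem dSOSPAn_nonneg (hc : 0 < c) (p : ℝ) (x y : Polyline E) : 0 ≤ dSOSPAn c p x y := by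
  have := dSOSPA_nonneg hc p x y
  unfold dSOSPAn
  split_ifs <;> positivity

theorem dSOSPAn_self (hc : 0 < c) {p : ℝ} (hp : p ≠ 0) (x : Polyline E) :
    dSOSPAn c p x x = 0 := by
  simp [dSOSPAn, dSOSPA_self hc hp]

/-- The quantity minimised by `dPLD c 1 X Y`. -/
noncomputable def matchingCost (c : ℝ) (X Y : PPSet E) (θ : Finset (Fin X.n × Fin Y.n)) : ℝ :=
  ∑ ij ∈ θ, (min (X.r ij.1) (Y.r ij.2) * dSOSPAn c 1 (X.poly ij.1) (Y.poly ij.2)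
      + |X.r ij.1 - Y.r ij.2| / 2)
    + (∑ i ∈ Finset.univ.filter (fun i => ∀ j, (i, j) ∉ θ), X.r i
        + ∑ j ∈ Finset.univ.filter (fun j => ∀ i, (i, j) ∉ θ), Y.r j) / 2

theorem dPLD_one (c : ℝ) (X Y : PPSet E) :
    dPLD c 1 X Y =
      ⨅ θ : {θ : Finset (Fin X.n × Fin Y.n) // IsAssignment θ}, matchingCost c X Y θ.1 := by
  simp only [dPLD, matchingCost, Real.rpow_one, div_one]

theorem dPLD_one_le_matchingCost (c : ℝ) (X Y : PPSet E) {θ : Finset (Fin X.n × Fin Y.n)}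
    (hθ : IsAssignment θ) : dPLD c 1 X Y ≤ matchingCost c X Y θ := by
  rw [dPLD_one]
  exact ciInf_le (Set.finite_range fun θ : {θ // IsAssignment θ} =>
    matchingCost c X Y θ.1).bddBelow ⟨θ, hθ⟩

theorem dPLD_one_le (c : ℝ) (X Y : PPSet E) : dPLD c 1 X Y ≤ (totalR X + totalR Y) / 2 :=
  (dPLD_one_le_matchingCost c X Y IsAssignment.empty).trans_eq <| by
    simp [matchingCost, totalR]

theorem abs_totalR_sub_le_dPLD_one (hc : 0 < c) (X Y : PPSet E) :
    |totalR X - totalR Y| / 2 ≤ dPLD c 1 X Y := by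
  have : Nonempty {θ : Finset (Fin X.n × Fin Y.n) // IsAssignment θ} := ⟨⟨∅, .empty⟩⟩
  rw [dPLD_one]
  refine le_ciInf fun ⟨θ, hθ⟩ => ?_
  have hX := hθ.sum_fst_add_sum_unmatched X.r
  have hY := hθ.sum_snd_add_sum_unmatched Y.r
  have hX₀ := Finset.sum_nonneg
    (s := Finset.univ.filter (fun i => ∀ j, (i, j) ∉ θ)) fun i _ => X.r_nonneg i
  have hY₀ := Finset.sum_nonneg
    (s := Finset.univ.filter (fun j => ∀ i, (i, j) ∉ θ)) fun j _ => Y.r_nonneg j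
  have hm : 0 ≤ ∑ ij ∈ θ,
      min (X.r ij.1) (Y.r ij.2) * dSOSPAn c 1 (X.poly ij.1) (Y.poly ij.2) :=
    Finset.sum_nonneg fun ij _ => mul_nonneg (le_min (X.r_nonneg _) (Y.r_nonneg _))
      (dSOSPAn_nonneg hc _ _ _)
  have habs := Finset.abs_sum_le_sum_abs (fun ij => X.r ij.1 - Y.r ij.2) θ
  rw [Finset.sum_sub_distrib] at habs
  rw [matchingCost, Finset.sum_add_distrib, ← Finset.sum_div, totalR, totalR, ← hX, ← hY]
  obtain ⟨hlo, hhi⟩ := abs_le.1 habs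
  have : |∑ ij ∈ θ, X.r ij.1 + ∑ i ∈ Finset.univ.filter (fun i => ∀ j, (i, j) ∉ θ), X.r i
      - (∑ ij ∈ θ, Y.r ij.2 + ∑ j ∈ Finset.univ.filter (fun j => ∀ i, (i, j) ∉ θ), Y.r j)| ≤
      ∑ ij ∈ θ, |X.r ij.1 - Y.r ij.2|
        + ∑ i ∈ Finset.univ.filter (fun i => ∀ j, (i, j) ∉ θ), X.r i
        + ∑ j ∈ Finset.univ.filter (fun j => ∀ i, (i, j) ∉ θ), Y.r j :=
    abs_le.2 ⟨by linarith, by linarith⟩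
  linarith

theorem dPLD_one_self (hc : 0 < c) (X : PPSet E) : dPLD c 1 X X = 0 := by
  refine le_antisymm ?_ ((by positivity : (0 : ℝ) ≤ |totalR X - totalR X| / 2).trans
    (abs_totalR_sub_le_dPLD_one hc X X))
  refine (dPLD_one_le_matchingCost c X X
    (IsOrderedAssignment.diagonal X.n).isAssignment).trans_eq ?_
  have hinj : Function.Injective fun i : Fin X.n => (i, i) := fun i j h => (Prod.ext_iff.1 h).1
  rw [matchingCost, Finset.sum_image hinj.injOn]
  simp [dSOSPAn_self hc one_ne_zero]

theorem SPLD_self (hc : 0 < c) (X : PPSet E) : SPLD c X X = totalR X / 2 := by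
  rw [SPLD, dPLD_one_self hc]
  ring

end

/-- For `p = 1`, the DAP similarity satisfies
`0 ≤ S_PLD^{(c,1)}(X,Y) ≤ (1/2)·min{R_X, R_Y} = min{S_PLD^{(c,1)}(X,X), S_PLD^{(c,1)}(Y,Y)}`. -/
theorem SPLD_nonneg_le_min {E : Type*} [MetricSpace E] (c : ℝ) (hc : 0 < c)
    (X Y : PPSet E) :
    0 ≤ SPLD c X Y ∧
    SPLD c X Y ≤ min (totalR X) (totalR Y) / 2 ∧
    min (totalR X) (totalR Y) / 2 = min (SPLD c X X) (SPLD c Y Y) := by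
  have hle := dPLD_one_le c X Y
  have hge := abs_totalR_sub_le_dPLD_one hc X Y
  refine ⟨?_, ?_, ?_⟩
  · rw [SPLD]
    linarith
  · rw [SPLD, div_le_div_iff_of_pos_right two_pos]
    have h₁ := le_abs_self (totalR X - totalR Y)
    have h₂ := neg_abs_le (totalR X - totalR Y)
    exact le_min (by linarith) (by linarith)
  · rw [SPLD_self hc, SPLD_self hc, min_div_div_right zero_le_two]
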